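/- Let M ≥ 1 be a natural number, 0 = l₀ < l₁ < ⋯ < l_M = 1, and for m = 1, …, M let ᾱ_m ≠ 0 and ψ_m ∈ ℝ. Let λ_n, λ_j ∈ ℝ with λ_n² ≠ λ_j², let Bi₁, Bi_M ∈ ℝ, and for m = 1, …, M−1 let φ_m, μ_m, η_m, ϕ_m ∈ ℝ with N_m := ϕ_m φ_m − η_m μ_m ≠ 0; set Ψ₁ = 1 and Ψ_{m+1} = Ψ_m / N_m. For m = 1, …, M let f_m, g_m : ℝ → ℝ be twice continuously differentiable on [l_{m−1}, l_m] with ᾱ_m f_m'' + ψ_m f_m = −λ_n² f_m and ᾱ_m g_m'' + ψ_m g_m = −λ_j² g_m on [l_{m−1}, l_m]. Assume the boundary conditions f₁'(0) = Bi₁ f₁(0), g₁'(0) = Bi₁ g₁(0), f_M'(1) = Bi_M f_M(1), g_M'(1) = Bi_M g_M(1), and for m = 1, …, M−1 the interface conditions f_{m+1}(l_m) = φ_m f_m(l_m) + μ_m f_m'(l_m), f_{m+1}'(l_m) = η_m f_m(l_m) + ϕ_m f_m'(l_m), and likewise for g. Then ∑_{m=1}^{M} (Ψ_m/ᾱ_m)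 ∫_{l_{m−1}}^{l_m} f_m(y) g_m(y) dy = 0. -/

import Mathlib

/-- Lagrange identity on a compact interval: two solutions of the same second-order linear equation,
with spectral parameters `p` and `q`, have a product whose integral is a difference of Wronskians. -/
theorem integral_mul_eq_wronskian_sub {a b c r p q : ℝ} (hab : a < b) (hc : c ≠ 0) {u v : ℝ → ℝ}
    (hu : ContDiffOn ℝ 2 u (Set.Icc a b)) (hv : ContDiffOn ℝ 2 v (Set.Icc a b))
    (hue : ∀ y ∈ Set.Icc a b,
      c * iteratedDerivWithin 2 u (Set.Icc a b) y + r * u y = -p * u y)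
    (hve : ∀ y ∈ Set.Icc a b,
      c * iteratedDerivWithin 2 v (Set.Icc a b) y + r * v y = -q * v y) :
    (q - p) / c * ∫ y in a..b, u y * v y =
      (derivWithin u (Set.Icc a b) b * v b - u b * derivWithin v (Set.Icc a b) b) -
        (derivWithin u (Set.Icc a b) a * v a - u a * derivWithin v (Set.Icc a b) a) := by
  have hs : UniqueDiffOn ℝ (Set.Icc a b) := uniqueDiffOn_Icc hab
  have hu' : ContDiffOn ℝ 1 (derivWithin u (Set.Icc a b)) (Set.Icc a b) :=
    hu.derivWithin hs (by norm_num)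
  have hv' : ContDiffOn ℝ 1 (derivWithin v (Set.Icc a b)) (Set.Icc a b) :=
    hv.derivWithin hs (by norm_num)
  have hasDeriv {w : ℝ → ℝ} {n : WithTop ℕ∞} (hn : n ≠ 0) (hw : ContDiffOn ℝ n w (Set.Icc a b))
      {x : ℝ} (hx : x ∈ Set.Ioo a b) : HasDerivAt w (derivWithin w (Set.Icc a b) x) x :=
    ((hw.differentiableOn hn) x (Set.Ioo_subset_Icc_self hx)).hasDerivWithinAt.hasDerivAt
      (Icc_mem_nhds hx.1 hx.2)
  rw [← intervalIntegral.integral_const_mul]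
  refine intervalIntegral.integral_eq_sub_of_hasDerivAt_of_le
    (f := fun y => derivWithin u (Set.Icc a b) y * v y - u y * derivWithin v (Set.Icc a b) y)
    hab.le ((hu'.continuousOn.mul hv.continuousOn).sub (hu.continuousOn.mul hv'.continuousOn))
    (fun x hx => ?_) ?_
  · have hx' := Set.Ioo_subset_Icc_self hx
    have h1 := hue x hx'
    have h2 := hve x hx'
    rw [iteratedDerivWithin_succ, iteratedDerivWithin_one] at h1 h2
    refine (((hasDeriv one_ne_zero hu' hx).mul (hasDeriv two_ne_zero hv hx)).sub
      ((hasDeriv two_ne_zero hu hx).mul (hasDeriv one_ne_zero hv' hx))).congr_deriv ?_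
    field_simp
    linear_combination v x * h1 - u x * h2
  · refine ContinuousOn.intervalIntegrable ?_
    rw [Set.uIcc_of_le hab.le]
    exact continuousOn_const.mul (hu.continuousOn.mul hv.continuousOn)

/-- Orthogonality relation for the spatial eigenfunctions of the multilayer
Sturm–Liouville problem: eigenfunctions associated with distinct temporal
eigenvalues are orthogonal with respect to the weights Ψₘ/ᾱₘ. -/
theorem stmt_12 (M : ℕ) (hM : 1 ≤ M) (l : ℕ → ℝ)
    (hl0 : l 0 = 0) (hlM : l M = 1)
    (hmono : ∀ m, m < M → l m < l (m + 1))
    (alpha psi : ℕ → ℝ)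
    (halpha : ∀ m, 1 ≤ m → m ≤ M → alpha m ≠ 0)
    (lamn lamj : ℝ) (hlam : lamn ^ 2 ≠ lamj ^ 2)
    (Bi1 BiM : ℝ)
    (φ μ η ϕ N Ψ : ℕ → ℝ)
    (hN : ∀ m, 1 ≤ m → m ≤ M - 1 → N m = ϕ m * φ m - η m * μ m)
    (hN0 : ∀ m, 1 ≤ m → m ≤ M - 1 → N m ≠ 0)
    (hΨ1 : Ψ 1 = 1)
    (hΨ : ∀ m, 1 ≤ m → m ≤ M - 1 → Ψ (m + 1) = Ψ m / N m)
    (f g : ℕ → ℝ → ℝ)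
    (hf : ∀ m, 1 ≤ m → m ≤ M →
      ContDiffOn ℝ 2 (f m) (Set.Icc (l (m - 1)) (l m)))
    (hg : ∀ m, 1 ≤ m → m ≤ M →
      ContDiffOn ℝ 2 (g m) (Set.Icc (l (m - 1)) (l m)))
    (hfe : ∀ m, 1 ≤ m → m ≤ M → ∀ y ∈ Set.Icc (l (m - 1)) (l m),
      alpha m * iteratedDerivWithin 2 (f m) (Set.Icc (l (m - 1)) (l m)) y
        + psi m * f m y = -lamn ^ 2 * f m y)
    (hge : ∀ m, 1 ≤ m → m ≤ M → ∀ y ∈ Set.Icc (l (m - 1)) (l m),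
      alpha m * iteratedDerivWithin 2 (g m) (Set.Icc (l (m - 1)) (l m)) y
        + psi m * g m y = -lamj ^ 2 * g m y)
    (hbcf0 : derivWithin (f 1) (Set.Icc (l 0) (l 1)) 0 = Bi1 * f 1 0)
    (hbcg0 : derivWithin (g 1) (Set.Icc (l 0) (l 1)) 0 = Bi1 * g 1 0)
    (hbcf1 : derivWithin (f M) (Set.Icc (l (M - 1)) (l M)) 1 = BiM * f M 1)
    (hbcg1 : derivWithin (g M) (Set.Icc (l (M - 1)) (l M)) 1 = BiM * g M 1)
    (hiff : ∀ m, 1 ≤ m → m ≤ M - 1 →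
      f (m + 1) (l m) = φ m * f m (l m)
          + μ m * derivWithin (f m) (Set.Icc (l (m - 1)) (l m)) (l m) ∧
      derivWithin (f (m + 1)) (Set.Icc (l m) (l (m + 1))) (l m)
        = η m * f m (l m)
          + ϕ m * derivWithin (f m) (Set.Icc (l (m - 1)) (l m)) (l m))
    (hifg : ∀ m, 1 ≤ m → m ≤ M - 1 →
      g (m + 1) (l m) = φ m * g m (l m)
          + μ m * derivWithin (g m) (Set.Icc (l (m - 1)) (l m)) (l m) ∧
      derivWithin (g (m + 1)) (Set.Icc (l m) (l (m + 1))) (l m)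
        = η m * g m (l m)
          + ϕ m * derivWithin (g m) (Set.Icc (l (m - 1)) (l m)) (l m)) :
    ∑ m ∈ Finset.Icc 1 M,
      (Ψ m / alpha m) * ∫ y in (l (m - 1))..(l m), f m y * g m y = 0 := by
  have key (m : ℕ) (h1 : 1 ≤ m) (hm : m ≤ M) :=
    have hlt : l (m - 1) < l m := by
      have := hmono (m - 1) (by omega)
      rwa [Nat.sub_add_cancel h1] at this
    integral_mul_eq_wronskian_sub hlt (halpha m h1 hm) (hf m h1 hm) (hg m h1 hm)
      (hfe m h1 hm) (hge m h1 hm)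
  have partial_sum (k : ℕ) (h1 : 1 ≤ k) : k ≤ M →
      (lamj ^ 2 - lamn ^ 2) * ∑ m ∈ Finset.Icc 1 k,
        (Ψ m / alpha m) * ∫ y in (l (m - 1))..(l m), f m y * g m y =
      Ψ k * (derivWithin (f k) (Set.Icc (l (k - 1)) (l k)) (l k) * g k (l k) -
        f k (l k) * derivWithin (g k) (Set.Icc (l (k - 1)) (l k)) (l k)) := by
    induction k, h1 using Nat.le_induction with
    | base =>
      intro hk
      have h := key 1 le_rfl hk
      simp only [Nat.sub_self, hl0] at h hbcf0 hbcg0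
      rw [hbcf0, hbcg0] at h
      simp only [Finset.Icc_self, Finset.sum_singleton, Nat.sub_self, hl0, hΨ1]
      linear_combination h
    | succ k hk1 ih =>
      intro hk
      have h := key (k + 1) (by omega) hk
      have hk' : k ≤ M - 1 := by omega
      have hN1 := hN0 k hk1 hk'
      have hΨN : Ψ (k + 1) * N k = Ψ k := by rw [hΨ k hk1 hk']; field_simp
      rw [hN k hk1 hk'] at hΨN
      rw [Finset.sum_Icc_succ_top (by omega), mul_add, ih (by omega)]
      simp only [Nat.add_sub_cancel] at h ⊢
      rw [(hiff k hk1 hk').1, (hiff k hk1 hk').2, (hifg k hk1 hk').1, (hifg k hk1 hk').2] at h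
      rw [← hΨN]
      linear_combination Ψ (k + 1) * h
  have h := partial_sum M hM le_rfl
  rw [hlM] at h hbcf1 hbcg1
  rw [hbcf1, hbcg1] at h
  refine (mul_eq_zero.mp (h.trans ?_)).resolve_left (sub_ne_zero.mpr hlam.symm)
  ring
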